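/- (Support of a centered random variable with a q-th moment bound.) Fix q ∈ (1,2] and C₀ > 0. There exists a constant C̄, depending only on q and C₀, such that for every a ∈ ℝ and every real-valued random variable ξ with E ξ = 0 and E|ξ|^q ≤ C₀⟨a⟩², where ⟨a⟩ := √(4+a²), one has P( −⟨a⟩/2 ≤ ξ ≤ C̄⟨a⟩^{1/(q−1)} ) > 0. -/

import Mathlib

open Real Set MeasureTheory

noncomputable section

/-- The Japanese bracket `⟨a⟩ = √(4 + a²)`. -/
def jbr (a : ℝ) : ℝ := Real.sqrt (4 + a ^ 2)

lemma two_le_jbr (a : ℝ) : 2 ≤ jbr a := by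
  refine Real.le_sqrt_of_sq_le ?_
  nlinarith [sq_nonneg a]

/-- A nonnegative function whose lower integral is at most `c` is integrable, with integral
at most `c`. -/
lemma integrable_and_integral_le_of_lintegral_ofReal_le {Ω : Type*} [MeasurableSpace Ω]
    {μ : Measure Ω} {f : Ω → ℝ} {c : ℝ} (hf : AEStronglyMeasurable f μ) (hf0 : 0 ≤ f)
    (hc : 0 ≤ c) (h : ∫⁻ ω, ENNReal.ofReal (f ω) ∂μ ≤ ENNReal.ofReal c) :
    Integrable f μ ∧ ∫ ω, f ω ∂μ ≤ c := by
  refine ⟨⟨hf, ?_⟩, ?_⟩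
  · rw [hasFiniteIntegral_iff_ofReal (ae_of_all μ hf0)]
    exact h.trans_lt ENNReal.ofReal_lt_top
  · rw [integral_eq_lintegral_of_nonneg_ae (ae_of_all μ hf0) hf]
    exact ENNReal.toReal_le_of_le_ofReal hc h

/-- If `x` avoids `[-b, m]` with `0 ≤ b ≤ m`, then `x + b` is controlled by `|x| ^ q`. -/
lemma add_le_two_mul_abs_rpow_div {q b m x : ℝ} (hq : 1 ≤ q) (hm : 0 < m) (hbm : b ≤ m)
    (hx : -b ≤ x → m < x) : x + b ≤ 2 * (|x| ^ q / m ^ (q - 1)) := by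
  rcases lt_or_ge x (-b) with hxb | hxb
  · have : 0 ≤ 2 * (|x| ^ q / m ^ (q - 1)) := by positivity
    linarith
  · have hmx : m < x := hx hxb
    have hx0 : 0 < x := hm.trans hmx
    have hpow : m ^ (q - 1) ≤ x ^ (q - 1) := rpow_le_rpow hm.le hmx.le (by linarith)
    have hxq : x ≤ |x| ^ q / m ^ (q - 1) := by
      rw [le_div_iff₀ (rpow_pos_of_pos hm _), abs_of_pos hx0]
      calc x * m ^ (q - 1) ≤ x * x ^ (q - 1) := by gcongr
        _ = x ^ q := by rw [mul_comm, ← rpow_add_one hx0.ne', sub_add_cancel]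
    linarith

/-- Support of a centered random variable with a `q`-th moment bound: if `E ξ = 0` and
`E|ξ|^q ≤ C₀⟨a⟩²`, then `ξ` lands in `[−⟨a⟩/2, C̄⟨a⟩^{1/(q−1)}]` with positive
probability, where `C̄` depends only on `q` and `C₀`. -/
theorem centered_rv_support
    (q C₀ : ℝ) (hq : q ∈ Ioc (1:ℝ) 2) (hC₀ : 0 < C₀) :
    ∃ Cbar : ℝ,
      ∀ (Ω : Type) [MeasurableSpace Ω] (P : Measure Ω), IsProbabilityMeasure P →
      ∀ (a : ℝ) (ξ : Ω → ℝ),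
        Measurable ξ → Integrable ξ P →
        (∫ ω, ξ ω ∂P) = 0 →
        (∫⁻ ω, ENNReal.ofReal (|ξ ω| ^ q) ∂P) ≤ ENNReal.ofReal (C₀ * jbr a ^ 2) →
        0 < P {ω | -(jbr a) / 2 ≤ ξ ω ∧ ξ ω ≤ Cbar * jbr a ^ (1 / (q - 1))} := by
  obtain ⟨hq1, hq2⟩ := hq
  have hq0 : 0 < q - 1 := by linarith
  refine ⟨(5 * C₀ + 1) ^ (1 / (q - 1)), ?_⟩
  intro Ω _ P _ a ξ hξm hξi hmean hmom
  have hJ : 2 ≤ jbr a := two_le_jbr a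
  rw [← mul_rpow (by positivity) (by linarith)]
  set J := jbr a
  set m := ((5 * C₀ + 1) * J) ^ (1 / (q - 1)) with hm_def
  have hKJ : J ≤ (5 * C₀ + 1) * J := by nlinarith
  have hJm : J ≤ m :=
    hKJ.trans (self_le_rpow_of_one_le (by linarith) (by rw [le_div_iff₀ hq0]; linarith))
  have hmq : m ^ (q - 1) = (5 * C₀ + 1) * J := by
    rw [hm_def, one_div, rpow_inv_rpow (by linarith) hq0.ne']
  obtain ⟨hint, hle⟩ := integrable_and_integral_le_of_lintegral_ofReal_le
    (hξm.abs.pow_const q).aestronglyMeasurable (fun ω => by positivity) (by positivity) hmom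
  rw [pos_iff_ne_zero]
  intro hzero
  have hae : ∀ᵐ ω ∂P, ξ ω + J / 2 ≤ 2 * (|ξ ω| ^ q / m ^ (q - 1)) := by
    filter_upwards [measure_eq_zero_iff_ae_notMem.mp hzero] with ω hω
    refine add_le_two_mul_abs_rpow_div hq1.le (by linarith) (by linarith) fun h => ?_
    by_contra! hle
    exact hω ⟨by linarith, hle⟩
  have hmono := integral_mono_ae (hξi.add (integrable_const (J / 2)))
    ((hint.div_const _).const_mul 2) hae
  simp only [Pi.add_apply] at hmono
  rw [integral_add hξi (integrable_const _), hmean, integral_const_mul, hmq] at hmono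
  simp only [integral_div, integral_const, probReal_univ, one_smul, zero_add] at hmono
  have hdiv : (∫ ω, |ξ ω| ^ q ∂P) / ((5 * C₀ + 1) * J) < J / 5 := by
    rw [div_lt_iff₀ (by positivity)]
    nlinarith
  linarith
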